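/- arXiv:2502.18069 — 11 statements merged into one kernel-verified Lean document; each statement's English description precedes it below -/
import Mathlib

section
/- Let C = aC_a ⊕ bC_b be a linear code of length n over H_23, where C_a is a binary linear code and C_b a ternary linear code. Then C^⊥ = aC_a^⊥ ⊕ b𝔽_3^n, where C_a^⊥ is the dual of C_a in 𝔽_2^n. Moreover (C^⊥)^⊥ = C if and only if C_b = 𝔽_3^n. -/
/-!
Common setup: the non-unital rings `H₂₃` and `H₃₂` of order 6, whose common
additive group is `ZMod 2 × ZMod 3`, and codes over them.
-/

/-- The common additive group of the rings `H₂₃` and `H₃₂`. -/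
abbrev Hring : Type := ZMod 2 × ZMod 3

/-- The element `a = (1,0)` of `H`. -/
def aH : Hring := (1, 0)

/-- The element `b = (0,1)` of `H`. -/
def bH : Hring := (0, 1)

/-- Multiplication of the non-unital ring `H₂₃`: `(x₁,y₁)·(x₂,y₂) = (x₁x₂, 0)`. -/
def mul23 (u v : Hring) : Hring := (u.1 * v.1, 0)

/-- Multiplication of the non-unital ring `H₃₂`: `(x₁,y₁)·(x₂,y₂) = (0, y₁y₂)`. -/
def mul32 (u v : Hring) : Hring := (0, u.2 * v.2)

/-- The vector `a·x` associated with a binary vector `x`: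
`(a·x)_j = a` if `x_j = 1` and `0` otherwise, i.e. `(a·x)_j = (x_j, 0)`. -/
def aVec {n : ℕ} (x : Fin n → ZMod 2) : Fin n → Hring := fun j => (x j, 0)

/-- The vector `b·y` associated with a ternary vector `y`:
`(b·y)_j = 0, b, 2b` according as `y_j = 0, 1, 2`, i.e. `(b·y)_j = (0, y_j)`. -/
def bVec {n : ℕ} (y : Fin n → ZMod 3) : Fin n → Hring := fun j => (0, y j)

/-- The code `a C_a ⊕ b C_b = {a·x + b·y : x ∈ C_a, y ∈ C_b}` over `H`. -/
def combCode {n : ℕ} (Ca : Set (Fin n → ZMod 2)) (Cb : Set (Fin n → ZMod 3)) :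
    Set (Fin n → Hring) :=
  { c | ∃ x ∈ Ca, ∃ y ∈ Cb, c = aVec x + bVec y }

/-- Inner product on `H^n` with respect to the multiplication `mul`. -/
def innerH {n : ℕ} (mul : Hring → Hring → Hring) (x y : Fin n → Hring) : Hring :=
  ∑ i, mul (x i) (y i)

/-- Standard inner product on `F^n`. -/
def innerF {F : Type*} [CommRing F] {n : ℕ} (x y : Fin n → F) : F :=
  ∑ i, x i * y i

/-- Dual of a code in `H^n` with respect to the multiplication `mul`. -/
def dualH {n : ℕ} (mul : Hring → Hring → Hring) (C : Set (Fin n → Hring)) :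
    Set (Fin n → Hring) :=
  { y | ∀ x ∈ C, innerH mul x y = 0 }

/-- Dual of a code in `F^n` with respect to the standard inner product. -/
def dualF {F : Type*} [CommRing F] {n : ℕ} (C : Set (Fin n → F)) : Set (Fin n → F) :=
  { y | ∀ x ∈ C, innerF x y = 0 }

/-- A linear code over `(H, mul)`: a nonempty subset of `H^n` closed under
componentwise addition and under (componentwise) multiplication by each ring element. -/
def IsLinearCode {n : ℕ} (mul : Hring → Hring → Hring) (C : Set (Fin n → Hring)) : Prop :=
  C.Nonempty ∧ (∀ u ∈ C, ∀ v ∈ C, u + v ∈ C) ∧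
    ∀ r : Hring, ∀ u ∈ C, (fun i => mul r (u i)) ∈ C

/-- Self-orthogonality of a code in `H^n`. -/
def SelfOrthH {n : ℕ} (mul : Hring → Hring → Hring) (C : Set (Fin n → Hring)) : Prop :=
  ∀ x ∈ C, ∀ y ∈ C, innerH mul x y = 0

/-- Self-orthogonality of a code over a finite field. -/
def SelfOrthF {F : Type*} [CommRing F] {n : ℕ} (C : Set (Fin n → F)) : Prop :=
  ∀ x ∈ C, ∀ y ∈ C, innerF x y = 0

/-- A quasi self-dual (QSD) code: self-orthogonal with `|C| = 6^(n/2)`. -/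
def QSD {n : ℕ} (mul : Hring → Hring → Hring) (C : Set (Fin n → Hring)) : Prop :=
  SelfOrthH mul C ∧ (Nat.card C : ℝ) = (6 : ℝ) ^ ((n : ℝ) / 2)

/-- Hamming weight: the number of nonzero coordinates. -/
def wt {β : Type*} [Zero β] [DecidableEq β] {n : ℕ} (v : Fin n → β) : ℕ :=
  (Finset.univ.filter (fun i => v i ≠ 0)).card

/-- `d` is the minimum distance of the code `C`: `d` is the least Hamming weight of a
nonzero codeword. -/
def IsMinDist {β : Type*} [Zero β] [DecidableEq β] {n : ℕ}
    (C : Set (Fin n → β)) (d : ℕ) : Prop :=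
  (∃ v ∈ C, v ≠ 0 ∧ wt v = d) ∧ ∀ v ∈ C, v ≠ 0 → d ≤ wt v

/-- A code is cyclic if it is closed under the cyclic shift
`(c₁, …, c_n) ↦ (c_n, c₁, …, c_{n-1})`. -/
def IsCyclicCode {β : Type*} {n : ℕ} (C : Set (Fin n → β)) : Prop :=
  ∀ c ∈ C, (fun i : Fin n => c ((finRotate n).symm i)) ∈ C

/-- The linear code over `(H, mul)` generated by a set `S` of vectors: the smallest
linear code containing `S`. -/
def genCode {n : ℕ} (mul : Hring → Hring → Hring) (S : Set (Fin n → Hring)) :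
    Set (Fin n → Hring) :=
  ⋂₀ { C | IsLinearCode mul C ∧ S ⊆ C }

lemma mem_combCode_iff {n : ℕ} (A : Set (Fin n → ZMod 2)) (B : Set (Fin n → ZMod 3))
    (c : Fin n → Hring) :
    c ∈ combCode A B ↔ (fun i => (c i).1) ∈ A ∧ (fun i => (c i).2) ∈ B := by
  constructor
  · rintro ⟨x, hx, y, hy, rfl⟩
    simpa [aVec, bVec] using And.intro hx hy
  · rintro ⟨hx, hy⟩
    refine ⟨_, hx, _, hy, ?_⟩
    funext i
    simp [aVec, bVec]

lemma innerH_mul23_eq_zero {n : ℕ} (x y : Fin n → Hring) :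
    innerH mul23 x y = 0 ↔ innerF (fun i => (x i).1) (fun i => (y i).1) = 0 := by
  simp [innerH, innerF, mul23, Prod.ext_iff, Prod.fst_sum, Prod.snd_sum]

lemma dualH_combCode {n : ℕ} (A : Set (Fin n → ZMod 2)) (B : Set (Fin n → ZMod 3))
    (hB : (0 : Fin n → ZMod 3) ∈ B) :
    dualH mul23 (combCode A B) = combCode (dualF A) Set.univ := by
  ext y
  rw [mem_combCode_iff]
  simp only [Set.mem_univ, and_true]
  constructor
  · intro h x hx
    have := h (aVec x) ((mem_combCode_iff _ _ _).2 ⟨hx, hB⟩)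
    exact (innerH_mul23_eq_zero _ _).1 this
  · intro h x hx
    exact (innerH_mul23_eq_zero _ _).2 (h _ ((mem_combCode_iff _ _ _).1 hx).1)

lemma dualF_dualF {n : ℕ} (A : Submodule (ZMod 2) (Fin n → ZMod 2)) :
    dualF (dualF (A : Set (Fin n → ZMod 2))) = (A : Set (Fin n → ZMod 2)) := by
  haveI : Fact (Nat.Prime 2) := ⟨Nat.prime_two⟩
  ext v
  constructor
  · intro h
    by_contra hv
    obtain ⟨f, hf, hA⟩ := Submodule.exists_le_ker_of_notMem hv
    have key : ∀ x, f x = ∑ i, x i * f (fun j => if i = j then 1 else 0) := fun x => by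
      simpa using LinearMap.pi_apply_eq_sum_univ f x
    apply hf
    rw [key]
    have := h (fun i => f (fun j => if i = j then 1 else 0)) (fun x hx => by
      have h0 : f x = 0 := hA hx
      rw [key] at h0
      exact h0)
    simpa [innerF, mul_comm] using this
  · intro hv y hy
    have := hy v hv
    simpa [innerF, mul_comm] using this

/-- For `C = a C_a ⊕ b C_b` over `H₂₃`, one has
`C^⊥ = a C_a^⊥ ⊕ b 𝔽₃ⁿ`, and `(C^⊥)^⊥ = C` iff `C_b = 𝔽₃ⁿ`. -/
theorem dual_combCode_H23 {n : ℕ}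
    (Ca : Submodule (ZMod 2) (Fin n → ZMod 2)) (Cb : Submodule (ZMod 3) (Fin n → ZMod 3)) :
    dualH mul23 (combCode (Ca : Set (Fin n → ZMod 2)) (Cb : Set (Fin n → ZMod 3))) =
        combCode (dualF (Ca : Set (Fin n → ZMod 2))) Set.univ ∧
      (dualH mul23 (dualH mul23
          (combCode (Ca : Set (Fin n → ZMod 2)) (Cb : Set (Fin n → ZMod 3)))) =
          combCode (Ca : Set (Fin n → ZMod 2)) (Cb : Set (Fin n → ZMod 3)) ↔
        (Cb : Set (Fin n → ZMod 3)) = Set.univ) := by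
  have h1 := dualH_combCode (Ca : Set (Fin n → ZMod 2)) (Cb : Set (Fin n → ZMod 3)) Cb.zero_mem
  refine ⟨h1, ?_⟩
  rw [h1, dualH_combCode _ _ (Set.mem_univ _), dualF_dualF]
  constructor
  · intro h
    rw [Set.eq_univ_iff_forall]
    intro y
    have : bVec y ∈ combCode (Ca : Set (Fin n → ZMod 2)) Set.univ :=
      (mem_combCode_iff _ _ _).2 ⟨Ca.zero_mem, Set.mem_univ _⟩
    rw [h] at this
    exact ((mem_combCode_iff _ _ _).1 this).2
  · intro h
    rw [h]
end

section
/- Let C = aC_a ⊕ bC_b be a linear code of length n over H_23, where C_a is a binary linear code and C_b a ternary linear code. Then C is nice, i.e. |C|·|C^⊥| = 6^n, if and only if C_b = {0}. -/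
theorem aux_card_comb {n : ℕ}
    (Ca : Submodule (ZMod 2) (Fin n → ZMod 2)) (Cb : Submodule (ZMod 3) (Fin n → ZMod 3)) :
    Nat.card (combCode (Ca : Set (Fin n → ZMod 2)) (Cb : Set (Fin n → ZMod 3))) =
      Nat.card Ca * Nat.card Cb := by
  rw [← Nat.card_prod]
  symm
  refine Nat.card_congr (Equiv.ofBijective
    (fun p : Ca × Cb => ⟨aVec p.1.1 + bVec p.2.1, p.1.1, p.1.2, p.2.1, p.2.2, rfl⟩) ⟨?_, ?_⟩)
  · rintro ⟨⟨x, hx⟩, ⟨y, hy⟩⟩ ⟨⟨x', hx'⟩, ⟨y', hy'⟩⟩ h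
    have h' := Subtype.ext_iff.1 h
    have hj := fun j => congrFun h' j
    simp only [aVec, bVec, Pi.add_apply, Prod.mk_add_mk, Prod.mk.injEq, add_zero, zero_add] at hj
    simp only [Prod.mk.injEq, Subtype.mk.injEq]
    exact ⟨funext fun j => (hj j).1, funext fun j => (hj j).2⟩
  · rintro ⟨c, x, hx, y, hy, rfl⟩
    exact ⟨⟨⟨x, hx⟩, ⟨y, hy⟩⟩, rfl⟩

theorem aux_inner {n : ℕ} (x : Fin n → ZMod 2) (y : Fin n → ZMod 3) (z : Fin n → Hring) :
    innerH mul23 (aVec x + bVec y) z = 0 ↔ ∑ i, (z i).1 * x i = 0 := by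
  unfold innerH mul23
  rw [Prod.ext_iff]
  simp [Prod.fst_sum, Prod.snd_sum, aVec, bVec, mul_comm]

theorem aux_card_dual {n : ℕ}
    (Ca : Submodule (ZMod 2) (Fin n → ZMod 2)) (Cb : Submodule (ZMod 3) (Fin n → ZMod 3)) :
    Nat.card (dualH mul23
      (combCode (Ca : Set (Fin n → ZMod 2)) (Cb : Set (Fin n → ZMod 3)))) =
      Nat.card Ca.dualAnnihilator * 3 ^ n := by
  have h3 : Nat.card (Fin n → ZMod 3) = 3 ^ n := by simp
  rw [← h3, ← Nat.card_prod]
  have key : ∀ z : Fin n → Hring, z ∈ dualH mul23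
      (combCode (Ca : Set (Fin n → ZMod 2)) (Cb : Set (Fin n → ZMod 3))) ↔
      dotProductEquiv (ZMod 2) (Fin n) (fun i => (z i).1) ∈ Ca.dualAnnihilator := by
    intro z
    rw [Submodule.mem_dualAnnihilator]
    constructor
    · intro h x hx
      exact (aux_inner x 0 z).1 (h _ ⟨x, hx, 0, Cb.zero_mem, rfl⟩)
    · rintro h _ ⟨x, hx, y, hy, rfl⟩
      exact (aux_inner x y z).2 (h x hx)
  refine Nat.card_congr (Equiv.ofBijective
    (fun z => (⟨_, (key z.1).1 z.2⟩, fun i => (z.1 i).2)) ⟨?_, ?_⟩)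
  · rintro ⟨z, hz⟩ ⟨w, hw⟩ h
    simp only [Prod.mk.injEq, Subtype.mk.injEq, EmbeddingLike.apply_eq_iff_eq] at h
    exact Subtype.ext (funext fun i => Prod.ext (congrFun h.1 i) (congrFun h.2 i))
  · rintro ⟨⟨f, hf⟩, y⟩
    obtain ⟨x, rfl⟩ := (dotProductEquiv (ZMod 2) (Fin n)).surjective f
    exact ⟨⟨fun i => (x i, y i), (key _).2 hf⟩, rfl⟩

theorem aux_card_ann {n : ℕ} (Ca : Submodule (ZMod 2) (Fin n → ZMod 2)) :
    Nat.card Ca * Nat.card Ca.dualAnnihilator = 2 ^ n := by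
  rw [Module.natCard_eq_pow_finrank (K := ZMod 2) (V := Ca),
    Module.natCard_eq_pow_finrank (K := ZMod 2) (V := Ca.dualAnnihilator), ← pow_add,
    Subspace.finrank_add_finrank_dualAnnihilator_eq]
  simp

/-- A code `C = a C_a ⊕ b C_b` over `H₂₃` is nice
(`|C|·|C^⊥| = 6^n`) iff `C_b = {0}`. -/
theorem nice_iff_H23 {n : ℕ}
    (Ca : Submodule (ZMod 2) (Fin n → ZMod 2)) (Cb : Submodule (ZMod 3) (Fin n → ZMod 3)) :
    Nat.card (combCode (Ca : Set (Fin n → ZMod 2)) (Cb : Set (Fin n → ZMod 3))) *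
        Nat.card (dualH mul23
          (combCode (Ca : Set (Fin n → ZMod 2)) (Cb : Set (Fin n → ZMod 3)))) = 6 ^ n ↔
      (Cb : Set (Fin n → ZMod 3)) = {0} := by
  rw [aux_card_comb, aux_card_dual]
  have h : Nat.card Ca * Nat.card Cb * (Nat.card Ca.dualAnnihilator * 3 ^ n) =
      6 ^ n * Nat.card Cb := by
    calc _ = (Nat.card Ca * Nat.card Ca.dualAnnihilator) * 3 ^ n * Nat.card Cb := by ring
      _ = _ := by rw [aux_card_ann, ← mul_pow]; norm_num
  rw [h]
  have h6 : 0 < 6 ^ n := by positivity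
  rw [Nat.mul_eq_left h6.ne']
  constructor
  · intro hc
    have hs := (Nat.card_eq_one_iff_unique.1 hc).1
    ext y
    simp only [SetLike.mem_coe, Set.mem_singleton_iff]
    constructor
    · intro hy
      exact congrArg Subtype.val (Subsingleton.elim (⟨y, hy⟩ : Cb) 0)
    · rintro rfl
      exact Cb.zero_mem
  · intro h0
    have hb : Cb = ⊥ := SetLike.coe_injective h0
    subst hb
    simp
end

section
/- Let C = aC_a ⊕ bC_b be a linear code of length n over H_32, where C_a is a binary linear code and C_b a ternary linear code. Then C is nice, i.e. |C|·|C^⊥| = 6^n, if and only if C_a = {0}. -/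
/-- Cardinality of a ternary code times that of its dual. -/
lemma card_mul_card_dualF {n : ℕ} (C : Submodule (ZMod 3) (Fin n → ZMod 3)) :
    Nat.card C * Nat.card (dualF (C : Set (Fin n → ZMod 3))) = 3 ^ n := by
  have : Fact (Nat.Prime 3) := ⟨Nat.prime_three⟩
  let W := C.map (dotProductEquiv (ZMod 3) (Fin n)).toLinearMap
  have h := Subspace.finrank_add_finrank_dualCoannihilator_eq W
  have hW : Module.finrank (ZMod 3) W = Module.finrank (ZMod 3) C :=
    LinearEquiv.finrank_map_eq _ _
  have hd : (W.dualCoannihilator : Set (Fin n → ZMod 3)) = dualF (C : Set (Fin n → ZMod 3)) := by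
    ext y
    rw [SetLike.mem_coe, Submodule.mem_dualCoannihilator]
    constructor
    · intro h x hx
      exact h _ (Submodule.mem_map_of_mem hx)
    · rintro h _ ⟨x, hx, rfl⟩
      exact h x hx
  rw [hW, Module.finrank_fin_fun] at h
  rw [← hd]
  change Nat.card C * Nat.card W.dualCoannihilator = _
  rw [Module.natCard_eq_pow_finrank (K := ZMod 3) (V := C),
    Module.natCard_eq_pow_finrank (K := ZMod 3) (V := W.dualCoannihilator), ← pow_add, h]
  simp

/-- Splitting a vector over `H` into its binary and ternary parts. -/
def splitH (n : ℕ) : (Fin n → Hring) ≃ (Fin n → ZMod 2) × (Fin n → ZMod 3) where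
  toFun c := (fun i => (c i).1, fun i => (c i).2)
  invFun p := fun i => (p.1 i, p.2 i)
  left_inv _ := rfl
  right_inv _ := rfl

lemma card_splitH {n : ℕ} (S : Set (Fin n → Hring)) (A : Set (Fin n → ZMod 2))
    (B : Set (Fin n → ZMod 3))
    (h : ∀ c, c ∈ S ↔ (splitH n c).1 ∈ A ∧ (splitH n c).2 ∈ B) :
    Nat.card S = Nat.card A * Nat.card B := by
  rw [← Nat.card_prod, ← Nat.card_congr (Equiv.Set.prod A B)]
  exact Nat.card_congr ((splitH n).subtypeEquiv fun c => by
    rw [h]; exact Iff.rfl)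

lemma card_combCode {n : ℕ} (A : Set (Fin n → ZMod 2)) (B : Set (Fin n → ZMod 3)) :
    Nat.card (combCode A B) = Nat.card A * Nat.card B := by
  apply card_splitH
  intro c
  constructor
  · rintro ⟨x, hx, y, hy, rfl⟩
    simpa [splitH, aVec, bVec] using And.intro hx hy
  · rintro ⟨hx, hy⟩
    refine ⟨_, hx, _, hy, ?_⟩
    ext i <;> simp [splitH, aVec, bVec]

lemma card_dualH {n : ℕ} (A : Set (Fin n → ZMod 2)) (hA : 0 ∈ A) (B : Set (Fin n → ZMod 3)) :
    Nat.card (dualH mul32 (combCode A B)) = 2 ^ n * Nat.card (dualF B) := by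
  have := card_splitH (dualH mul32 (combCode A B)) Set.univ (dualF B) (fun c => by
    simp only [Set.mem_univ, true_and]
    constructor
    · intro hc y hy
      have := congrArg Prod.snd (hc _ ⟨0, hA, y, hy, rfl⟩)
      simpa [innerH, mul32, innerF, splitH, aVec, bVec, Prod.snd_sum] using this
    · rintro hc _ ⟨x, hx, y, hy, rfl⟩
      have := hc y hy
      ext
      · simp [innerH, mul32, Prod.fst_sum]
      · simpa [innerH, mul32, innerF, splitH, aVec, bVec, Prod.snd_sum] using this)
  rw [this]
  simp

/-- A code `C = a C_a ⊕ b C_b` over `H₃₂` is nice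
(`|C|·|C^⊥| = 6^n`) iff `C_a = {0}`. -/
theorem nice_iff_H32 {n : ℕ}
    (Ca : Submodule (ZMod 2) (Fin n → ZMod 2)) (Cb : Submodule (ZMod 3) (Fin n → ZMod 3)) :
    Nat.card (combCode (Ca : Set (Fin n → ZMod 2)) (Cb : Set (Fin n → ZMod 3))) *
        Nat.card (dualH mul32
          (combCode (Ca : Set (Fin n → ZMod 2)) (Cb : Set (Fin n → ZMod 3)))) = 6 ^ n ↔
      (Ca : Set (Fin n → ZMod 2)) = {0} := by
  rw [card_combCode, card_dualH _ (by simp)]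
  have h3 := card_mul_card_dualF Cb
  have e : Nat.card (Ca : Set (Fin n → ZMod 2)) * Nat.card (Cb : Set (Fin n → ZMod 3)) *
      (2 ^ n * Nat.card (dualF (Cb : Set (Fin n → ZMod 3)))) = Nat.card Ca * 6 ^ n := by
    rw [show (6 : ℕ) = 2 * 3 from rfl, mul_pow, ← h3]
    change Nat.card Ca * Nat.card Cb * _ = _
    ring
  rw [e, Nat.mul_eq_right (by positivity)]
  rw [← Submodule.bot_coe (R := ZMod 2), SetLike.coe_set_eq]
  constructor
  · intro h
    have := (Nat.card_eq_one_iff_unique.mp h).1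
    exact Submodule.eq_bot_of_subsingleton
  · rintro rfl
    simp
end

section
/- Let C = aC_a ⊕ bC_b be a linear code of length n over H_23, where C_a is a binary linear code and C_b a ternary linear code. Then C is self-orthogonal if and only if C_a is a self-orthogonal binary code. -/
/-- A code `C = a C_a ⊕ b C_b` over `H₂₃` is self-orthogonal iff
`C_a` is a self-orthogonal binary code. -/
theorem selfOrth_iff_H23 {n : ℕ}
    (Ca : Submodule (ZMod 2) (Fin n → ZMod 2)) (Cb : Submodule (ZMod 3) (Fin n → ZMod 3)) :
    SelfOrthH mul23 (combCode (Ca : Set (Fin n → ZMod 2)) (Cb : Set (Fin n → ZMod 3))) ↔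
      SelfOrthF (Ca : Set (Fin n → ZMod 2)) := by
  have key : ∀ (x x2 : Fin n → ZMod 2) (y y2 : Fin n → ZMod 3),
      innerH mul23 (aVec x + bVec y) (aVec x2 + bVec y2) = (innerF x x2, 0) := by
    intro x x2 y y2
    simp only [innerH, innerF, mul23, aVec, bVec, Pi.add_apply, Prod.mk_add_mk, add_zero]
    ext
    · rw [Prod.fst_sum]
    · rw [Prod.snd_sum]
      simp
  constructor
  · intro h x hx x2 hx2
    have h1 := h _ ⟨x, hx, 0, Cb.zero_mem, rfl⟩ _ ⟨x2, hx2, 0, Cb.zero_mem, rfl⟩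
    rw [key] at h1
    exact congrArg Prod.fst h1
  · rintro h _ ⟨x, hx, y, _, rfl⟩ _ ⟨x2, hx2, y2, _, rfl⟩
    rw [key, h x hx x2 hx2]
    rfl
end

section
/- Let C = aC_a ⊕ bC_b be a linear code of length n over H_32, where C_a is a binary linear code and C_b a ternary linear code. Then C is self-orthogonal if and only if C_b is a self-orthogonal ternary code. -/
/-- A code `C = a C_a ⊕ b C_b` over `H₃₂` is self-orthogonal iff
`C_b` is a self-orthogonal ternary code. -/
theorem selfOrth_iff_H32 {n : ℕ}
    (Ca : Submodule (ZMod 2) (Fin n → ZMod 2)) (Cb : Submodule (ZMod 3) (Fin n → ZMod 3)) :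
    SelfOrthH mul32 (combCode (Ca : Set (Fin n → ZMod 2)) (Cb : Set (Fin n → ZMod 3))) ↔
      SelfOrthF (Cb : Set (Fin n → ZMod 3)) := by
  have key : ∀ (x x' : Fin n → ZMod 2) (y y' : Fin n → ZMod 3),
      innerH mul32 (aVec x + bVec y) (aVec x' + bVec y') = (0, innerF y y') := by
    intro x x' y y'
    ext <;> simp [innerH, innerF, mul32, aVec, bVec, Prod.fst_sum, Prod.snd_sum]
  constructor
  · intro h y hy y' hy'
    have := h _ ⟨0, Ca.zero_mem, y, hy, rfl⟩ _ ⟨0, Ca.zero_mem, y', hy', rfl⟩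
    rw [key] at this
    exact congrArg Prod.snd this
  · rintro h _ ⟨x, _, y, hy, rfl⟩ _ ⟨x', _, y', hy', rfl⟩
    rw [key, h y hy y' hy']
    rfl
end

section
/- Let C₁ ⊆ 𝔽_2^n be a self-orthogonal binary linear code and C₂ ⊆ 𝔽_3^n any ternary linear code. Then the set C = aC₁ ⊕ bC₂ ⊆ H_23^n is a linear code over H_23 (closed under addition and under multiplication by every element of H_23) and is self-orthogonal. Moreover, if |C₁|·|C₂| = 6^{n/2}, then C is quasi self-dual. -/
/-- If `C₁` is a self-orthogonal binary linear code and `C₂` any ternary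
linear code, then `C = a C₁ ⊕ b C₂` is a self-orthogonal linear code over `H₂₃`;
moreover if `|C₁|·|C₂| = 6^(n/2)` then `C` is quasi self-dual. -/
theorem build_selfOrth_H23 {n : ℕ}
    (C1 : Submodule (ZMod 2) (Fin n → ZMod 2)) (C2 : Submodule (ZMod 3) (Fin n → ZMod 3))
    (h1 : SelfOrthF (C1 : Set (Fin n → ZMod 2))) :
    IsLinearCode mul23 (combCode (C1 : Set (Fin n → ZMod 2)) (C2 : Set (Fin n → ZMod 3))) ∧
      SelfOrthH mul23 (combCode (C1 : Set (Fin n → ZMod 2)) (C2 : Set (Fin n → ZMod 3))) ∧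
      ((Nat.card C1 : ℝ) * (Nat.card C2 : ℝ) = (6 : ℝ) ^ ((n : ℝ) / 2) →
        QSD mul23 (combCode (C1 : Set (Fin n → ZMod 2)) (C2 : Set (Fin n → ZMod 3)))) := by
  have hso : SelfOrthH mul23
      (combCode (C1 : Set (Fin n → ZMod 2)) (C2 : Set (Fin n → ZMod 3))) := by
    rintro _ ⟨x, hx, y, hy, rfl⟩ _ ⟨x', hx', y', hy', rfl⟩
    have h := h1 x hx x' hx'
    unfold innerF at h
    unfold innerH
    ext
    · simpa [mul23, aVec, bVec, Prod.fst_sum] using h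
    · simp [mul23, Prod.snd_sum]
  refine ⟨⟨⟨_, 0, C1.zero_mem, 0, C2.zero_mem, rfl⟩, ?_, ?_⟩, hso, ?_⟩
  · rintro _ ⟨x, hx, y, hy, rfl⟩ _ ⟨x', hx', y', hy', rfl⟩
    refine ⟨x + x', C1.add_mem hx hx', y + y', C2.add_mem hy hy', ?_⟩
    funext j
    ext <;> simp [aVec, bVec]
  · rintro r _ ⟨x, hx, y, hy, rfl⟩
    refine ⟨r.1 • x, C1.smul_mem _ hx, 0, C2.zero_mem, ?_⟩
    funext j
    ext <;> simp [aVec, bVec, mul23]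
  · intro hc
    refine ⟨hso, ?_⟩
    rw [← hc, ← Nat.cast_mul, ← Nat.card_prod]
    congr 1
    symm
    refine Nat.card_congr (Equiv.ofBijective
      (fun p : C1 × C2 => (⟨aVec p.1.1 + bVec p.2.1, p.1.1, p.1.2, p.2.1, p.2.2, rfl⟩ :
        combCode (C1 : Set (Fin n → ZMod 2)) (C2 : Set (Fin n → ZMod 3)))) ⟨?_, ?_⟩)
    · rintro ⟨⟨x, hx⟩, ⟨y, hy⟩⟩ ⟨⟨x', hx'⟩, ⟨y', hy'⟩⟩ h
      have h2 := congrArg Subtype.val h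
      have hxx : x = x' := by
        funext j
        have h3 := congrArg Prod.fst (congrFun h2 j)
        simpa [aVec, bVec] using h3
      have hyy : y = y' := by
        funext j
        have h3 := congrArg Prod.snd (congrFun h2 j)
        simpa [aVec, bVec] using h3
      subst hxx hyy
      rfl
    · rintro ⟨_, x, hx, y, hy, rfl⟩
      exact ⟨(⟨x, hx⟩, ⟨y, hy⟩), rfl⟩
end

section
/- Let C₁ ⊆ 𝔽_2^n be any binary linear code and C₂ ⊆ 𝔽_3^n a self-orthogonal ternary linear code. Then the set C = aC₁ ⊕ bC₂ ⊆ H_32^n is a linear code over H_32 (closed under addition and under multiplication by every element of H_32) and is self-orthogonal. Moreover, if |C₁|·|C₂| = 6^{n/2}, then C is quasi self-dual. -/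
/-- If `C₁` is any binary linear code and `C₂` a self-orthogonal ternary
linear code, then `C = a C₁ ⊕ b C₂` is a self-orthogonal linear code over `H₃₂`;
moreover if `|C₁|·|C₂| = 6^(n/2)` then `C` is quasi self-dual. -/
theorem build_selfOrth_H32 {n : ℕ}
    (C1 : Submodule (ZMod 2) (Fin n → ZMod 2)) (C2 : Submodule (ZMod 3) (Fin n → ZMod 3))
    (h2 : SelfOrthF (C2 : Set (Fin n → ZMod 3))) :
    IsLinearCode mul32 (combCode (C1 : Set (Fin n → ZMod 2)) (C2 : Set (Fin n → ZMod 3))) ∧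
      SelfOrthH mul32 (combCode (C1 : Set (Fin n → ZMod 2)) (C2 : Set (Fin n → ZMod 3))) ∧
      ((Nat.card C1 : ℝ) * (Nat.card C2 : ℝ) = (6 : ℝ) ^ ((n : ℝ) / 2) →
        QSD mul32 (combCode (C1 : Set (Fin n → ZMod 2)) (C2 : Set (Fin n → ZMod 3)))) := by
  have hS : SelfOrthH mul32
      (combCode (C1 : Set (Fin n → ZMod 2)) (C2 : Set (Fin n → ZMod 3))) := by
    rintro _ ⟨x, hx, y, hy, rfl⟩ _ ⟨x', hx', y', hy', rfl⟩
    have h := h2 y hy y' hy'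
    unfold innerF at h
    unfold innerH
    ext
    · simp [mul32, Prod.fst_sum]
    · simpa [mul32, Prod.snd_sum, aVec, bVec] using h
  refine ⟨⟨⟨_, 0, C1.zero_mem, 0, C2.zero_mem, rfl⟩, ?_, ?_⟩, hS, fun hc => ⟨hS, ?_⟩⟩
  · rintro _ ⟨x, hx, y, hy, rfl⟩ _ ⟨x', hx', y', hy', rfl⟩
    refine ⟨x + x', C1.add_mem hx hx', y + y', C2.add_mem hy hy', ?_⟩
    funext i
    simp [aVec, bVec]
  · rintro r _ ⟨x, hx, y, hy, rfl⟩
    refine ⟨0, C1.zero_mem, r.2 • y, C2.smul_mem _ hy, ?_⟩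
    funext i
    simp [aVec, bVec, mul32]
  · rw [← hc, ← Nat.cast_mul, ← Nat.card_prod]
    congr 1
    symm
    refine Nat.card_congr (Equiv.ofBijective
      (fun p : C1 × C2 => ⟨aVec p.1.1 + bVec p.2.1, p.1.1, p.1.2, p.2.1, p.2.2, rfl⟩) ⟨?_, ?_⟩)
    · rintro ⟨⟨x, hx⟩, ⟨y, hy⟩⟩ ⟨⟨x', hx'⟩, ⟨y', hy'⟩⟩ h
      have h' : aVec x + bVec y = aVec x' + bVec y' := congrArg Subtype.val h
      have e1 : x = x' := by
        funext i
        simpa [aVec, bVec] using congrArg Prod.fst (congrFun h' i)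
      have e2 : y = y' := by
        funext i
        simpa [aVec, bVec] using congrArg Prod.snd (congrFun h' i)
      subst e1 e2
      rfl
    · rintro ⟨_, x, hx, y, hy, rfl⟩
      exact ⟨(⟨x, hx⟩, ⟨y, hy⟩), rfl⟩
end

section
/- Let C = aC_a ⊕ bC_b be a linear code of length n over H_32, where C_a is a binary linear code and C_b a ternary linear code. Then C is self-dual (C = C^⊥) if and only if C_a = 𝔽_2^n and C_b is a self-dual ternary code. -/
theorem mem_combCode_iff_H {n : ℕ} (Ca : Set (Fin n → ZMod 2)) (Cb : Set (Fin n → ZMod 3))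
    (c : Fin n → Hring) :
    c ∈ combCode Ca Cb ↔ (fun i => (c i).1) ∈ Ca ∧ (fun i => (c i).2) ∈ Cb := by
  constructor
  · rintro ⟨x, hx, y, hy, rfl⟩
    simpa [aVec, bVec] using And.intro hx hy
  · rintro ⟨hx, hy⟩
    refine ⟨_, hx, _, hy, ?_⟩
    funext i
    simp [aVec, bVec]

theorem innerH_mul32_eq_zero_iff {n : ℕ} (x y : Fin n → Hring) :
    innerH mul32 x y = 0 ↔ innerF (fun i => (x i).2) (fun i => (y i).2) = 0 := by
  simp [innerH, innerF, mul32, Prod.ext_iff, Prod.fst_sum, Prod.snd_sum]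

theorem mem_dualH_combCode_iff {n : ℕ} (Ca : Submodule (ZMod 2) (Fin n → ZMod 2))
    (Cb : Set (Fin n → ZMod 3)) (c : Fin n → Hring) :
    c ∈ dualH mul32 (combCode (Ca : Set (Fin n → ZMod 2)) Cb) ↔
      (fun i => (c i).2) ∈ dualF Cb := by
  constructor
  · intro h y hy
    exact (innerH_mul32_eq_zero_iff (fun i => (0, y i)) c).1
      (h _ ((mem_combCode_iff_H _ _ _).2 ⟨Ca.zero_mem, hy⟩))
  · intro h x hx
    exact (innerH_mul32_eq_zero_iff x c).2 (h _ ((mem_combCode_iff_H _ _ _).1 hx).2)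

/-- A code `C = a C_a ⊕ b C_b` over `H₃₂` is self-dual iff
`C_a = 𝔽₂ⁿ` and `C_b` is a self-dual ternary code. -/
theorem selfDual_iff_H32 {n : ℕ}
    (Ca : Submodule (ZMod 2) (Fin n → ZMod 2)) (Cb : Submodule (ZMod 3) (Fin n → ZMod 3)) :
    combCode (Ca : Set (Fin n → ZMod 2)) (Cb : Set (Fin n → ZMod 3)) =
        dualH mul32 (combCode (Ca : Set (Fin n → ZMod 2)) (Cb : Set (Fin n → ZMod 3))) ↔
      ((Ca : Set (Fin n → ZMod 2)) = Set.univ ∧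
        (Cb : Set (Fin n → ZMod 3)) = dualF (Cb : Set (Fin n → ZMod 3))) := by
  have key : ∀ c : Fin n → Hring, _ := fun c => mem_combCode_iff_H (Ca : Set (Fin n → ZMod 2)) Cb c
  have key2 : ∀ c : Fin n → Hring, _ := fun c => mem_dualH_combCode_iff Ca Cb c
  rw [Set.ext_iff]
  simp only [key, key2]
  constructor
  · intro h
    have h0 : (0 : Fin n → ZMod 3) ∈ dualF (Cb : Set (Fin n → ZMod 3)) := by
      intro x _
      simp [innerF]
    have hA : (Ca : Set (Fin n → ZMod 2)) = Set.univ :=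
      Set.eq_univ_of_forall fun x => ((h (fun i => (x i, 0))).2 h0).1
    refine ⟨hA, Set.ext fun y => ?_⟩
    exact ⟨fun hy => (h (fun i => (0, y i))).1 ⟨Ca.zero_mem, hy⟩,
      fun hy => ((h (fun i => (0, y i))).2 hy).2⟩
  · rintro ⟨hA, hB⟩ c
    rw [hA, ← hB]
    simp
end

section
/- Let z ∈ {23, 32} and let C = aC_a ⊕ bC_b be a linear code of length n over H_z, where C_a is a binary linear code and C_b a ternary linear code. Then C is a cyclic code if and only if C_a and C_b are both cyclic codes. -/
/-- A code `C = a C_a ⊕ b C_b` over `H_z` (`z ∈ {23,32}`; the set `C`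
is the same for both rings) is cyclic iff `C_a` and `C_b` are both cyclic. -/
theorem cyclic_iff_combCode {n : ℕ}
    (Ca : Submodule (ZMod 2) (Fin n → ZMod 2)) (Cb : Submodule (ZMod 3) (Fin n → ZMod 3)) :
    IsCyclicCode (combCode (Ca : Set (Fin n → ZMod 2)) (Cb : Set (Fin n → ZMod 3))) ↔
      (IsCyclicCode (Ca : Set (Fin n → ZMod 2)) ∧
        IsCyclicCode (Cb : Set (Fin n → ZMod 3))) := by
  have key : ∀ c : Fin n → Hring,
      c ∈ combCode (Ca : Set (Fin n → ZMod 2)) (Cb : Set (Fin n → ZMod 3)) ↔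
        (fun i => (c i).1) ∈ Ca ∧ (fun i => (c i).2) ∈ Cb := by
    intro c
    constructor
    · rintro ⟨x, hx, y, hy, rfl⟩
      have h1 : (fun i => ((aVec x + bVec y) i).1) = x := by
        funext i; simp [aVec, bVec]
      have h2 : (fun i => ((aVec x + bVec y) i).2) = y := by
        funext i; simp [aVec, bVec]
      rw [h1, h2]
      exact ⟨hx, hy⟩
    · rintro ⟨h1, h2⟩
      refine ⟨_, h1, _, h2, ?_⟩
      funext i
      simp [aVec, bVec]
  constructor
  · intro h
    constructor
    · intro x hx
      exact ((key _).1 (h (fun i => (x i, 0)) ((key _).2 ⟨hx, Cb.zero_mem⟩))).1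
    · intro y hy
      exact ((key _).1 (h (fun i => (0, y i)) ((key _).2 ⟨Ca.zero_mem, hy⟩))).2
  · rintro ⟨ha, hb⟩ c hc
    have hc' := (key c).1 hc
    exact (key _).2 ⟨ha _ hc'.1, hb _ hc'.2⟩
end

section
/- Let C₀ be a self-orthogonal linear code of length n over H_23 generated by vectors r₁, …, r_k ∈ H_23^n, let x ∈ {0,1}^n have an odd number of coordinates equal to 1, and let α ∈ J_a = {0, a}. For 1 ≤ i ≤ k set y_i = Σ_{j : x_j = 1} r_{ij} ∈ H_23, and let αx ∈ H_23^n have j-th coordinate α if x_j = 1 and 0 otherwise. Then the linear code of length n + 2 over H_23 generated by the k + 1 vectors (α, 0, αx), (y₁, y₁, r₁), …, (y_k, y_k, r_k) is self-orthogonal. -/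
theorem innerH23_eq {n : ℕ} (u v : Fin n → Hring) :
    innerH mul23 u v = (∑ i, (u i).1 * (v i).1, 0) := by
  ext <;> simp [innerH, mul23, Prod.fst_sum, Prod.snd_sum]

theorem innerH23_zero_iff {n : ℕ} (u v : Fin n → Hring) :
    innerH mul23 u v = 0 ↔ ∑ i, (u i).1 * (v i).1 = 0 := by
  rw [innerH23_eq]; simp [Prod.ext_iff]

theorem innerH23_comm {n : ℕ} (u v : Fin n → Hring) :
    innerH mul23 u v = innerH mul23 v u := by
  simp [innerH23_eq, mul_comm]

theorem isLinearCode_dual23 {n : ℕ} (S : Set (Fin n → Hring)) :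
    IsLinearCode mul23 (dualH mul23 S) := by
  refine ⟨⟨0, fun x _ => ?_⟩, fun u hu v hv x hx => ?_, fun c u hu x hx => ?_⟩
  · rw [innerH23_zero_iff]; simp
  · have h1 := (innerH23_zero_iff _ _).1 (hu x hx)
    have h2 := (innerH23_zero_iff _ _).1 (hv x hx)
    rw [innerH23_zero_iff]
    simp [mul_add, Finset.sum_add_distrib, h1, h2]
  · have h1 := (innerH23_zero_iff _ _).1 (hu x hx)
    rw [innerH23_zero_iff]
    simp only [mul23, mul_left_comm, ← Finset.mul_sum, h1, mul_zero]

theorem selfOrth_gen23 {n : ℕ} (S : Set (Fin n → Hring))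
    (h : ∀ u ∈ S, ∀ v ∈ S, innerH mul23 u v = 0) :
    SelfOrthH mul23 (genCode mul23 S) := by
  have h1 : ∀ u ∈ S, ∀ v ∈ genCode mul23 S, innerH mul23 u v = 0 := fun u hu v hv =>
    hv _ ⟨isLinearCode_dual23 S, fun w hw z hz => h z hz w hw⟩ u hu
  intro u hu v hv
  rw [innerH23_comm]
  exact hu _ ⟨isLinearCode_dual23 (genCode mul23 S), fun w hw z hz => by
    rw [innerH23_comm]; exact h1 w hw z hz⟩ v hv

/-- Build-up construction over `H₂₃`, first form: from a self-orthogonal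
code of length `n` generated by `r₁, …, r_k`, a binary vector `x` of odd weight, and
`α ∈ J_a = {0, a}`, the code of length `n+2` generated by `(α, 0, αx)` and the vectors
`(yᵢ, yᵢ, rᵢ)` (with `yᵢ = (x, rᵢ) = ∑_{j : x_j = 1} r_{ij}`) is self-orthogonal. -/
theorem buildup_H23_length_two {n k : ℕ}
    (C0 : Set (Fin n → Hring)) (r : Fin k → Fin n → Hring)
    (hgen : C0 = genCode mul23 (Set.range r))
    (hso : SelfOrthH mul23 C0)
    (x : Fin n → ZMod 2)
    (hx : Odd (Finset.univ.filter (fun j => x j = 1)).card)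
    (α : Hring) (hα : α ∈ ({0, aH} : Set Hring))
    (y : Fin k → Hring)
    (hy : ∀ i, y i = ∑ j ∈ Finset.univ.filter (fun j => x j = 1), r i j) :
    SelfOrthH mul23 (genCode mul23
      (insert
        (Fin.cons α (Fin.cons 0 (fun j => if x j = 1 then α else 0)) : Fin (n + 2) → Hring)
        (Set.range (fun i =>
          (Fin.cons (y i) (Fin.cons (y i) (r i)) : Fin (n + 2) → Hring))))) := by
  have h2 : ∀ z : ZMod 2, z + z = 0 := by decide
  have hr : ∀ i j, ∑ l, (r i l).1 * (r j l).1 = 0 := fun i j => by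
    rw [← innerH23_zero_iff]
    have hm : ∀ i, r i ∈ C0 := fun i => by
      rw [hgen]
      exact fun C hC => hC.2 ⟨i, rfl⟩
    exact hso _ (hm i) _ (hm j)
  have hy1 : ∀ i, (y i).1 = ∑ j, if x j = 1 then (r i j).1 else 0 := fun i => by
    rw [hy, Prod.fst_sum, Finset.sum_filter]
  have hxr : ∀ i, ∑ j, (if x j = 1 then α else 0 : Hring).1 * (r i j).1 = α.1 * (y i).1 :=
    fun i => by
      rw [hy1, Finset.mul_sum]
      refine Finset.sum_congr rfl fun j _ => ?_
      split_ifs <;> simp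
  have hxx : ∑ j, (if x j = 1 then α else 0 : Hring).1 * (if x j = 1 then α else 0 : Hring).1
      = α.1 * α.1 := by
    have : ∀ j, (if x j = 1 then α else 0 : Hring).1 * (if x j = 1 then α else 0 : Hring).1
      = if x j = 1 then α.1 * α.1 else 0 := fun j => by split_ifs <;> simp
    simp only [this]
    rw [← Finset.sum_filter, Finset.sum_const, nsmul_eq_mul, ZMod.natCast_eq_one_iff_odd.2 hx,
      one_mul]
  have hmix : ∀ i, innerH mul23
      (Fin.cons α (Fin.cons 0 (fun j => if x j = 1 then α else 0)) : Fin (n + 2) → Hring)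
      (Fin.cons (y i) (Fin.cons (y i) (r i)) : Fin (n + 2) → Hring) = 0 := fun i => by
    rw [innerH23_zero_iff]
    simp only [Fin.sum_univ_succ, Fin.cons_zero, Fin.cons_succ, hxr, Prod.fst_zero, zero_mul,
      zero_add, h2]
  apply selfOrth_gen23
  rintro u (rfl | ⟨i, rfl⟩) v (rfl | ⟨j, rfl⟩)
  · rw [innerH23_zero_iff]
    simp only [Fin.sum_univ_succ, Fin.cons_zero, Fin.cons_succ, hxx, Prod.fst_zero, zero_mul,
      zero_add, h2]
  · exact hmix j
  · rw [innerH23_comm]; exact hmix i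
  · rw [innerH23_zero_iff]
    simp only [Fin.sum_univ_succ, Fin.cons_zero, Fin.cons_succ, hr, add_zero, h2]
end

section
/- Let C₀ be a self-orthogonal linear code of length n over H_32 generated by vectors r₁, …, r_k ∈ H_32^n, let x ∈ {0,1,2}^n, and let α, β, γ ∈ H_32 with α + β + γ = 0. For 1 ≤ i ≤ k set y_i = Σ_{j=1}^n x_j r_{ij} ∈ H_32 (integer multiples in the additive group of H_32), and let γx ∈ H_32^n have j-th coordinate x_j·γ. Suppose either (i) Σ_{j=1}^n x_j² ≡ 1 (mod 3) and α² + β² + γ² = 0, or (ii) Σ_{j=1}^n x_j² ≡ 2 (mod 3) and α² + β² − γ² = 0. Then the linear code of length n + 3 over H_32 generated by the k + 1 vectors (α, β, 0, γx), (y₁, y₁, y₁, r₁), …, (y_k, y_k, y_k, r_k) is self-orthogonal. -/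
theorem innerH32_eq {n : ℕ} (u v : Fin n → Hring) :
    innerH mul32 u v = (0, ∑ i, (u i).2 * (v i).2) := by
  unfold innerH mul32
  ext
  · simp [Prod.fst_sum]
  · simp [Prod.snd_sum]

theorem innerH32_zero {n : ℕ} (u v : Fin n → Hring) :
    innerH mul32 u v = 0 ↔ ∑ i, (u i).2 * (v i).2 = 0 := by
  rw [innerH32_eq, Prod.ext_iff]
  simp

theorem innerH32_comm {n : ℕ} (u v : Fin n → Hring) :
    innerH mul32 u v = innerH mul32 v u := by
  simp only [innerH32_eq, mul_comm]

theorem dualH32_linear {n : ℕ} (S : Set (Fin n → Hring)) :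
    IsLinearCode mul32 (dualH mul32 S) := by
  refine ⟨⟨0, ?_⟩, ?_, ?_⟩
  · intro x _
    rw [innerH32_zero]
    simp
  · intro u hu v hv x hx
    have h1 := (innerH32_zero _ _).1 (hu x hx)
    have h2 := (innerH32_zero _ _).1 (hv x hx)
    rw [innerH32_zero]
    simp [mul_add, Finset.sum_add_distrib, h1, h2]
  · intro c u hu x hx
    have h1 := (innerH32_zero _ _).1 (hu x hx)
    rw [innerH32_zero]
    simp only [mul32, mul_left_comm _ c.2]
    rw [← Finset.mul_sum, h1, mul_zero]

theorem genCode_selfOrth {n : ℕ} (S : Set (Fin n → Hring))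
    (h : ∀ u ∈ S, ∀ v ∈ S, innerH mul32 u v = 0) :
    SelfOrthH mul32 (genCode mul32 S) := by
  have h1 : genCode mul32 S ⊆ dualH mul32 S :=
    Set.sInter_subset_of_mem ⟨dualH32_linear S, fun v hv u hu => h u hu v hv⟩
  have h2 : genCode mul32 S ⊆ dualH mul32 (genCode mul32 S) :=
    Set.sInter_subset_of_mem ⟨dualH32_linear _, fun v hv u hu => by
      rw [innerH32_comm]; exact h1 hu v hv⟩
  exact fun u hu v hv => h2 hv u hu

/-- Build-up construction over `H₃₂`: from a self-orthogonal code of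
length `n` generated by `r₁, …, r_k`, a ternary vector `x`, and `α, β, γ ∈ H₃₂` with
`α + β + γ = 0`, if either `(x,x) = 1` and `α² + β² + γ² = 0`, or `(x,x) = -1` and
`α² + β² - γ² = 0`, then the code of length `n+3` generated by `(α, β, 0, γx)` and the
vectors `(yᵢ, yᵢ, yᵢ, rᵢ)` (with `yᵢ = (x, rᵢ) = ∑_j x_j • r_{ij}`) is self-orthogonal. -/
theorem buildup_H32 {n k : ℕ}
    (C0 : Set (Fin n → Hring)) (r : Fin k → Fin n → Hring)
    (hgen : C0 = genCode mul32 (Set.range r))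
    (hso : SelfOrthH mul32 C0)
    (x : Fin n → ZMod 3)
    (α β γ : Hring) (hsum : α + β + γ = 0)
    (y : Fin k → Hring)
    (hy : ∀ i, y i = ∑ j, (x j).val • r i j)
    (γx : Fin n → Hring)
    (hγx : ∀ j, γx j = (x j).val • γ)
    (hcase :
      ((∑ j, (x j) ^ 2) = (1 : ZMod 3) ∧
          mul32 α α + mul32 β β + mul32 γ γ = 0) ∨
        ((∑ j, (x j) ^ 2) = (2 : ZMod 3) ∧
          mul32 α α + mul32 β β - mul32 γ γ = 0)) :
    SelfOrthH mul32 (genCode mul32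
      (insert (Fin.cons α (Fin.cons β (Fin.cons 0 γx)) : Fin (n + 3) → Hring)
        (Set.range (fun i =>
          (Fin.cons (y i) (Fin.cons (y i) (Fin.cons (y i) (r i))) :
            Fin (n + 3) → Hring))))) := by
  have hr : ∀ i i', ∑ j, (r i j).2 * (r i' j).2 = 0 := by
    intro i i'
    rw [← innerH32_zero]
    have hm : ∀ i, r i ∈ C0 := fun i => by
      rw [hgen]
      exact fun C hC => hC.2 ⟨i, rfl⟩
    exact hso _ (hm i) _ (hm i')
  have hy2 : ∀ i, (y i).2 = ∑ j, x j * (r i j).2 := by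
    intro i
    rw [hy i, Prod.snd_sum]
    simp
  have hg2 : ∀ j, (γx j).2 = x j * γ.2 := by
    intro j
    rw [hγx j]
    simp
  have hs2 : α.2 + β.2 + γ.2 = 0 := congrArg Prod.snd hsum
  have h3 : (3 : ZMod 3) = 0 := rfl
  have hmix : ∀ i, α.2 * (y i).2 + (β.2 * (y i).2 + ∑ j, (γx j).2 * (r i j).2) = 0 := by
    intro i
    have : ∑ j, (γx j).2 * (r i j).2 = γ.2 * (y i).2 := by
      rw [hy2, Finset.mul_sum]
      exact Finset.sum_congr rfl fun j _ => by rw [hg2]; ring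
    rw [this]
    linear_combination (y i).2 * hs2
  apply genCode_selfOrth
  rintro u (rfl | ⟨i, rfl⟩) v (rfl | ⟨i', rfl⟩) <;> rw [innerH32_zero] <;>
    simp only [Fin.sum_univ_succ, Fin.cons_zero, Fin.cons_succ]
  · have hgg : ∑ j, (γx j).2 * (γx j).2 = (∑ j, x j ^ 2) * γ.2 ^ 2 := by
      rw [Finset.sum_mul]
      exact Finset.sum_congr rfl fun j _ => by rw [hg2]; ring
    rw [hgg]
    rcases hcase with ⟨h, hc⟩ | ⟨h, hc⟩
    · have hc2 : α.2 * α.2 + β.2 * β.2 + γ.2 * γ.2 = 0 := congrArg Prod.snd hc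
      rw [h, Prod.snd_zero]
      linear_combination hc2
    · have hc2 : α.2 * α.2 + β.2 * β.2 - γ.2 * γ.2 = 0 := congrArg Prod.snd hc
      rw [h, Prod.snd_zero]
      linear_combination hc2 + γ.2 ^ 2 * h3
  · rw [Prod.snd_zero]
    linear_combination hmix i'
  · have := hmix i
    simp only [mul_comm (γx _).2] at this
    rw [Prod.snd_zero]
    linear_combination this
  · rw [hr]
    linear_combination (y i).2 * (y i').2 * h3
end
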